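/- Consider bicomplete categories K, M, N, P and four adjunctions: V₁ : M → K with right adjoint R₁ : K → M; U₁ : N → K with left adjoint L₁ : K → N; U₂ : P → M with left adjoint L₂ : M → P; and V₂ : P → N with right adjoint R₂ : N → P. Suppose K carries a model structure (F, C, W); suppose N carries the right-induced model structure created by U₁ (fibrations U₁⁻¹F, weak equivalences U₁⁻¹W, cofibrations llp(U₁⁻¹(F ∩ W))); suppose M carries the left-induced model structure created by V₁ (cofibrations V₁⁻¹C, weak equivalences V₁⁻¹W, fibrations rlp(V₁⁻¹(C ∩ W))). Assume the natural isomorphisms U₁ ∘ V₂ ≅ V₁ ∘ U₂ and U₂ ∘ R₂ ≅ R₁ ∘ U₁ (equivalently L₁ ∘ V₁ ≅ V₂ ∘ L₂). Write F_M, W_M for the fibrations and weak equivalences of M and C_N, W_N for the cofibrations and weak equivalences of N, and assume moreover that the four pairs (llp(U₂⁻¹F_M), U₂⁻¹F_M), (llp(U₂⁻¹(F_M ∩ W_M)), U₂⁻¹(F_M ∩ W_M)), (V₂⁻¹C_N, rlp(V₂⁻¹C_N)), and (V₂⁻¹(C_N ∩ W_N), rlp(V₂⁻¹(C_N ∩ W_N)))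 are weak factorization systems on P. Then: (a) P admits the right-induced model structure P_right created by U₂ (fibrations U₂⁻¹F_M, weak equivalences U₂⁻¹W_M); (b) P admits the left-induced model structure P_left created by V₂ (cofibrations V₂⁻¹C_N, weak equivalences V₂⁻¹W_N); (c) P_right and P_left have the same class of weak equivalences; and (d) the identity functor is a left Quillen functor from P_right to P_left, i.e., every cofibration of P_right is a cofibration of P_left and every fibration of P_left is a fibration of P_right. -/

import Mathlib

open CategoryTheory Limits

universe v₁ u₁ v₂ u₂ v₃ u₃ v₄ u₄

namespace InducedModel

variable {M : Type u₁} [Category.{v₁} M]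

/-- The class of morphisms having the left lifting property with respect to
every morphism in `R`. -/
def llp (R : MorphismProperty M) : MorphismProperty M :=
  fun _ _ f => ∀ ⦃X Y : M⦄ (g : X ⟶ Y), R g → HasLiftingProperty f g

/-- The class of morphisms having the right lifting property with respect to
every morphism in `L`. -/
def rlp (L : MorphismProperty M) : MorphismProperty M :=
  fun _ _ g => ∀ ⦃X Y : M⦄ (f : X ⟶ Y), L f → HasLiftingProperty f g

/-- `(L, R)` is a weak factorization system. -/
structure IsWFS (L R : MorphismProperty M) : Prop where
  factor : ∀ ⦃X Y : M⦄ (f : X ⟶ Y),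
    ∃ (Z : M) (i : X ⟶ Z) (p : Z ⟶ Y), L i ∧ R p ∧ i ≫ p = f
  left_eq : L = llp R
  right_eq : R = rlp L

/-- `W` satisfies the 2-of-3 property. -/
def TwoOfThree (W : MorphismProperty M) : Prop :=
  (∀ ⦃X Y Z : M⦄ (f : X ⟶ Y) (g : Y ⟶ Z), W f → W g → W (f ≫ g)) ∧
  (∀ ⦃X Y Z : M⦄ (f : X ⟶ Y) (g : Y ⟶ Z), W g → W (f ≫ g) → W f) ∧
  (∀ ⦃X Y Z : M⦄ (f : X ⟶ Y) (g : Y ⟶ Z), W f → W (f ≫ g) → W g)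

/-- `P` is closed under retracts (in the arrow category). -/
def RetractClosed (P : MorphismProperty M) : Prop :=
  ∀ ⦃X Y X' Y' : M⦄ (f : X ⟶ Y) (g : X' ⟶ Y'),
    (∃ (i : Arrow.mk f ⟶ Arrow.mk g) (r : Arrow.mk g ⟶ Arrow.mk f), i ≫ r = 𝟙 _) →
    P g → P f

/-- Quillen's axioms for a model category structure with fibrations `F`,
cofibrations `C` and weak equivalences `W`. -/
structure IsModelCategory (F C W : MorphismProperty M) : Prop where
  two_of_three : TwoOfThree W
  retract_fib : RetractClosed F
  retract_cof : RetractClosed C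
  retract_weq : RetractClosed W
  lift_acof_fib : ∀ ⦃A B X Y : M⦄ (i : A ⟶ B) (p : X ⟶ Y),
    C i → W i → F p → HasLiftingProperty i p
  lift_cof_afib : ∀ ⦃A B X Y : M⦄ (i : A ⟶ B) (p : X ⟶ Y),
    C i → F p → W p → HasLiftingProperty i p
  fact_acof_fib : ∀ ⦃X Y : M⦄ (f : X ⟶ Y),
    ∃ (Z : M) (i : X ⟶ Z) (p : Z ⟶ Y), C i ∧ W i ∧ F p ∧ i ≫ p = f
  fact_cof_afib : ∀ ⦃X Y : M⦄ (f : X ⟶ Y),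
    ∃ (Z : M) (i : X ⟶ Z) (p : Z ⟶ Y), C i ∧ F p ∧ W p ∧ i ≫ p = f

end InducedModel

namespace InducedModel

section Lifting

variable {M : Type u₁} [Category.{v₁} M]

lemma RetractClosed.of_retractArrow {Q : MorphismProperty M} (hQ : RetractClosed Q)
    {X Y X' Y' : M} {f : X ⟶ Y} {g : X' ⟶ Y'} (h : RetractArrow f g) (hg : Q g) : Q f :=
  hQ f g ⟨h.i, h.r, h.retract⟩ hg

lemma RetractClosed.of_arrow_iso {Q : MorphismProperty M} (hQ : RetractClosed Q)
    {X Y X' Y' : M} {f : X ⟶ Y} {g : X' ⟶ Y'} (e : Arrow.mk f ≅ Arrow.mk g) (hg : Q g) : Q f :=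
  hQ f g ⟨e.hom, e.inv, e.hom_inv_id⟩ hg

lemma retractClosed_llp (R : MorphismProperty M) : RetractClosed (llp R) := by
  rintro X Y X' Y' f g ⟨i, r, h⟩ hg A B p hp
  have := hg p hp
  exact RetractArrow.leftLiftingProperty (h := (⟨i, r, h⟩ : RetractArrow f g)) p

lemma retractClosed_rlp (L : MorphismProperty M) : RetractClosed (rlp L) := by
  rintro X Y X' Y' f g ⟨i, r, h⟩ hg A B p hp
  have := hg p hp
  exact RetractArrow.rightLiftingProperty (h := (⟨i, r, h⟩ : RetractArrow f g)) p

lemma IsWFS.retractClosed_left {L R : MorphismProperty M} (h : IsWFS L R) : RetractClosed L :=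
  h.left_eq ▸ retractClosed_llp R

lemma IsWFS.retractClosed_right {L R : MorphismProperty M} (h : IsWFS L R) : RetractClosed R :=
  h.right_eq ▸ retractClosed_rlp L

lemma IsWFS.hasLiftingProperty {L R : MorphismProperty M} (h : IsWFS L R)
    {A B X Y : M} {i : A ⟶ B} {p : X ⟶ Y} (hi : L i) (hp : R p) : HasLiftingProperty i p := by
  rw [h.left_eq] at hi
  exact hi p hp

end Lifting

section Induction

variable {M : Type u₁} [Category.{v₁} M] {M' : Type u₂} [Category.{v₂} M']

lemma TwoOfThree.inverseImage {W : MorphismProperty M'} (hW : TwoOfThree W) (G : M ⥤ M') :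
    TwoOfThree (W.inverseImage G) := by
  obtain ⟨h₁, h₂, h₃⟩ := hW
  refine ⟨fun X Y Z f g hf hg => ?_, fun X Y Z f g hg hfg => ?_, fun X Y Z f g hf hfg => ?_⟩
  · exact (G.map_comp f g ▸ h₁ _ _ hf hg : W (G.map (f ≫ g)))
  · exact h₂ (G.map f) (G.map g) hg (G.map_comp f g ▸ hfg)
  · exact h₃ (G.map f) (G.map g) hf (G.map_comp f g ▸ hfg)

lemma RetractClosed.inverseImage {Q : MorphismProperty M'} (hQ : RetractClosed Q) (G : M ⥤ M') :
    RetractClosed (Q.inverseImage G) := by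
  rintro X Y X' Y' f g ⟨i, r, h⟩ hg
  exact hQ.of_retractArrow (RetractArrow.map ⟨i, r, h⟩ G) hg

lemma inverseImage_eq_of_iso {Q : MorphismProperty M'} (hQ : RetractClosed Q) {G G' : M ⥤ M'}
    (e : G ≅ G') : Q.inverseImage G = Q.inverseImage G' := by
  ext X Y f
  exact ⟨hQ.of_arrow_iso ((Arrow.isoOfNatIso e (Arrow.mk f)).symm),
    hQ.of_arrow_iso (Arrow.isoOfNatIso e (Arrow.mk f))⟩

end Induction

section ModelCategory

variable {M : Type u₁} [Category.{v₁} M] {F C W : MorphismProperty M}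

lemma IsModelCategory.llp_fib_le (h : IsModelCategory F C W) : llp F ≤ C ⊓ W := by
  intro X Y f hf
  obtain ⟨Z, i, p, hiC, hiW, hp, fac⟩ := h.fact_acof_fib f
  have := hf p hp
  have r := RetractArrow.ofLeftLiftingProperty fac
  exact ⟨h.retract_cof.of_retractArrow r hiC, h.retract_weq.of_retractArrow r hiW⟩

lemma IsModelCategory.rlp_cof_le (h : IsModelCategory F C W) : rlp C ≤ F ⊓ W := by
  intro X Y f hf
  obtain ⟨Z, i, p, hi, hpF, hpW, fac⟩ := h.fact_cof_afib f
  have := hf i hi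
  have r := RetractArrow.ofRightLiftingProperty fac
  exact ⟨h.retract_fib.of_retractArrow r hpF, h.retract_weq.of_retractArrow r hpW⟩

/-- Two weak factorization systems `(C, F ⊓ W)` and `(A, F)` determine a model structure as soon
as every morphism of `A` is a weak equivalence. -/
lemma IsModelCategory.of_left_le_weq {A : MorphismProperty M} (hW : TwoOfThree W)
    (hWr : RetractClosed W) (h : IsWFS C (F ⊓ W)) (h' : IsWFS A F) (hA : A ≤ W) :
    IsModelCategory F C W where
  two_of_three := hW
  retract_fib := h'.retractClosed_right
  retract_cof := h.retractClosed_left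
  retract_weq := hWr
  lift_acof_fib A' B X Y i p hi hiW hp := by
    obtain ⟨Z, j, q, hj, hq, fac⟩ := h'.factor i
    have hqW : W q := hW.2.2 j q (hA _ hj) (fac ▸ hiW)
    have := h.hasLiftingProperty hi (p := q) ⟨hq, hqW⟩
    exact h'.hasLiftingProperty
      (h'.retractClosed_left.of_retractArrow (RetractArrow.ofLeftLiftingProperty fac) hj) hp
  lift_cof_afib A' B X Y i p hi hp hpW := h.hasLiftingProperty hi ⟨hp, hpW⟩
  fact_acof_fib X Y f := by
    obtain ⟨Z, i, p, hi, hp, fac⟩ := h'.factor f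
    refine ⟨Z, i, p, ?_, hA _ hi, hp, fac⟩
    rw [h.left_eq]
    exact fun _ _ q hq => h'.hasLiftingProperty hi hq.1
  fact_cof_afib X Y f := by
    obtain ⟨Z, i, p, hi, hp, fac⟩ := h.factor f
    exact ⟨Z, i, p, hi, hp.1, hp.2, fac⟩

/-- Two weak factorization systems `(C, T)` and `(C ⊓ W, F)` determine a model structure as soon
as every morphism of `T` is a weak equivalence. -/
lemma IsModelCategory.of_right_le_weq {T : MorphismProperty M} (hW : TwoOfThree W)
    (hWr : RetractClosed W) (h : IsWFS C T) (h' : IsWFS (C ⊓ W) F) (hT : T ≤ W) :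
    IsModelCategory F C W where
  two_of_three := hW
  retract_fib := h'.retractClosed_right
  retract_cof := h.retractClosed_left
  retract_weq := hWr
  lift_acof_fib A B X Y i p hi hiW hp := h'.hasLiftingProperty ⟨hi, hiW⟩ hp
  lift_cof_afib A B X Y i p hi hp hpW := by
    obtain ⟨Z, j, q, hj, hq, fac⟩ := h.factor p
    have hjW : W j := hW.2.1 j q (hT _ hq) (fac ▸ hpW)
    have := h'.hasLiftingProperty (i := j) ⟨hj, hjW⟩ hp
    exact h.hasLiftingProperty hi
      (h.retractClosed_right.of_retractArrow (RetractArrow.ofRightLiftingProperty fac) hq)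
  fact_acof_fib X Y f := by
    obtain ⟨Z, i, p, hi, hp, fac⟩ := h'.factor f
    exact ⟨Z, i, p, hi.1, hi.2, hp, fac⟩
  fact_cof_afib X Y f := by
    obtain ⟨Z, i, p, hi, hp, fac⟩ := h.factor f
    refine ⟨Z, i, p, hi, ?_, hT _ hp, fac⟩
    rw [h'.right_eq]
    exact fun _ _ j hj => h.hasLiftingProperty hj.1 hp

end ModelCategory

section Square

variable {K : Type u₁} [Category.{v₁} K] {M : Type u₂} [Category.{v₂} M]
  {N : Type u₃} [Category.{v₃} N] {P : Type u₄} [Category.{v₄} P]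
  {V₁ : M ⥤ K} {R₁ : K ⥤ M} {U₁ : N ⥤ K} {L₂ : M ⥤ P} {U₂ : P ⥤ M} {V₂ : P ⥤ N} {R₂ : N ⥤ P}

lemma hasLiftingProperty_square_iff (adj₁ : V₁ ⊣ R₁) (iso : R₂ ⋙ U₂ ≅ U₁ ⋙ R₁)
    {A B : M} (i : A ⟶ B) {X Y : N} (g : X ⟶ Y) :
    HasLiftingProperty i (U₂.map (R₂.map g)) ↔ HasLiftingProperty (V₁.map i) (U₁.map g) := by
  rw [adj₁.hasLiftingProperty_iff]
  exact HasLiftingProperty.iff_of_arrow_iso_right i (Arrow.isoOfNatIso iso (Arrow.mk g))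

/-- If the morphisms of `C` lift against those of `F`, then `V₂` sends
`llp (U₂⁻¹ (rlp (V₁⁻¹ C)))` into `llp (U₁⁻¹ F)`. -/
lemma llp_inverseImage_le (adj₁ : V₁ ⊣ R₁) (adj₄ : V₂ ⊣ R₂) (iso : R₂ ⋙ U₂ ≅ U₁ ⋙ R₁)
    {C F : MorphismProperty K} (h : C ≤ llp F) :
    llp ((rlp (C.inverseImage V₁)).inverseImage U₂) ≤
      (llp (F.inverseImage U₁)).inverseImage V₂ := by
  intro X Y f hf A B g hg
  rw [adj₄.hasLiftingProperty_iff]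
  exact hf _ fun _ _ i hi => (hasLiftingProperty_square_iff adj₁ iso i g).2 (h _ hi _ hg)

/-- If the morphisms of `C` lift against those of `F`, then `U₂` sends
`rlp (V₂⁻¹ (llp (U₁⁻¹ F)))` into `rlp (V₁⁻¹ C)`. -/
lemma rlp_inverseImage_le (adj₁ : V₁ ⊣ R₁) (adj₃ : L₂ ⊣ U₂) (adj₄ : V₂ ⊣ R₂)
    (iso : R₂ ⋙ U₂ ≅ U₁ ⋙ R₁) {C F : MorphismProperty K} (h : C ≤ llp F) :
    rlp ((llp (F.inverseImage U₁)).inverseImage V₂) ≤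
      (rlp (C.inverseImage V₁)).inverseImage U₂ := by
  intro X Y f hf A B i hi
  rw [← adj₃.hasLiftingProperty_iff]
  refine hf _ fun _ _ g hg => ?_
  rw [adj₄.hasLiftingProperty_iff, adj₃.hasLiftingProperty_iff]
  exact (hasLiftingProperty_square_iff adj₁ iso i g).2 (h _ hi _ hg)

end Square

/-- **Theorem 2.3.1 (adjoint squares).** Given a square of adjunctions between
bicomplete categories `K`, `M`, `N`, `P` (with `V₁ ⊣ R₁`, `L₁ ⊣ U₁`,
`L₂ ⊣ U₂`, `V₂ ⊣ R₂`), a model structure `(F, C, W)` on `K`, the right-induced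
model structure on `N` (created by `U₁`), the left-induced model structure on
`M` (created by `V₁`), natural isomorphisms `U₁ ∘ V₂ ≅ V₁ ∘ U₂` and
`U₂ ∘ R₂ ≅ R₁ ∘ U₁`, and assuming the four induced weak factorization systems
exist on `P`, then: (a) the right-induced model structure (created by `U₂`)
exists on `P`; (b) the left-induced model structure (created by `V₂`) exists
on `P`; (c) the two model structures have the same weak equivalences; and
(d) the identity is a left Quillen functor from the right-induced structure to
the left-induced one. -/
theorem adjoint_square
    {K : Type u₁} [Category.{v₁} K] [HasLimits K] [HasColimits K]
    {M : Type u₂} [Category.{v₂} M] [HasLimits M] [HasColimits M]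
    {N : Type u₃} [Category.{v₃} N] [HasLimits N] [HasColimits N]
    {P : Type u₄} [Category.{v₄} P] [HasLimits P] [HasColimits P]
    (F C W : MorphismProperty K)
    (hK : IsModelCategory F C W)
    (V₁ : M ⥤ K) (R₁ : K ⥤ M) (adj₁ : V₁ ⊣ R₁)
    (L₁ : K ⥤ N) (U₁ : N ⥤ K) (adj₂ : L₁ ⊣ U₁)
    (L₂ : M ⥤ P) (U₂ : P ⥤ M) (adj₃ : L₂ ⊣ U₂)
    (V₂ : P ⥤ N) (R₂ : N ⥤ P) (adj₄ : V₂ ⊣ R₂)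
    -- the fibrations and weak equivalences of the left-induced structure on M,
    -- and the cofibrations and weak equivalences of the right-induced structure on N
    (FM WM : MorphismProperty M) (CN WN : MorphismProperty N)
    (hFM : FM = rlp ((C ⊓ W).inverseImage V₁)) (hWM : WM = W.inverseImage V₁)
    (hCN : CN = llp ((F ⊓ W).inverseImage U₁)) (hWN : WN = W.inverseImage U₁)
    -- N carries the right-induced model structure created by U₁
    (hN : IsModelCategory (F.inverseImage U₁) CN WN)
    -- M carries the left-induced model structure created by V₁
    (hM : IsModelCategory FM (C.inverseImage V₁) WM)
    -- the natural isomorphisms U₁ ∘ V₂ ≅ V₁ ∘ U₂ and U₂ ∘ R₂ ≅ R₁ ∘ U₁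
    (iso₁ : V₂ ⋙ U₁ ≅ U₂ ⋙ V₁)
    (iso₂ : R₂ ⋙ U₂ ≅ U₁ ⋙ R₁)
    -- the four induced weak factorization systems exist on P
    (hwfsP₁ : IsWFS (llp (FM.inverseImage U₂)) (FM.inverseImage U₂))
    (hwfsP₂ : IsWFS (llp ((FM ⊓ WM).inverseImage U₂)) ((FM ⊓ WM).inverseImage U₂))
    (hwfsP₃ : IsWFS (CN.inverseImage V₂) (rlp (CN.inverseImage V₂)))
    (hwfsP₄ : IsWFS ((CN ⊓ WN).inverseImage V₂) (rlp ((CN ⊓ WN).inverseImage V₂))) :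
    -- (a) the right-induced model structure on P, created by U₂
    IsModelCategory (FM.inverseImage U₂) (llp ((FM ⊓ WM).inverseImage U₂))
        (WM.inverseImage U₂) ∧
    -- (b) the left-induced model structure on P, created by V₂
    IsModelCategory (rlp ((CN ⊓ WN).inverseImage V₂)) (CN.inverseImage V₂)
        (WN.inverseImage V₂) ∧
    -- (c) the two structures have the same weak equivalences
    WM.inverseImage U₂ = WN.inverseImage V₂ ∧
    -- (d) id : P_right ⟶ P_left is left Quillen: every cofibration of P_right
    -- is a cofibration of P_left, and every fibration of P_left is a
    -- fibration of P_right
    llp ((FM ⊓ WM).inverseImage U₂) ≤ CN.inverseImage V₂ ∧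
    rlp ((CN ⊓ WN).inverseImage V₂) ≤ FM.inverseImage U₂ := by
  have hCF : C ≤ llp (F ⊓ W) := fun _ _ i hi _ _ p hp => hK.lift_cof_afib i p hi hp.1 hp.2
  have hCF' : C ⊓ W ≤ llp F := fun _ _ i hi _ _ p hp => hK.lift_acof_fib i p hi.1 hi.2 hp
  have hAN : CN ⊓ WN = llp (F.inverseImage U₁) :=
    le_antisymm (fun _ _ i hi _ _ p hp => hN.lift_acof_fib i p hi.1 hi.2 hp) hN.llp_fib_le
  have hAM : FM ⊓ WM = rlp (C.inverseImage V₁) :=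
    le_antisymm (fun _ _ p hp _ _ i hi => hM.lift_cof_afib i p hi hp.1 hp.2) hM.rlp_cof_le
  have hWeq : WM.inverseImage U₂ = WN.inverseImage V₂ := by
    rw [hWM, hWN]
    exact (inverseImage_eq_of_iso hK.retract_weq iso₁).symm
  refine ⟨.of_left_le_weq (hM.two_of_three.inverseImage U₂) (hM.retract_weq.inverseImage U₂)
    hwfsP₂ hwfsP₁ ?_, .of_right_le_weq (hN.two_of_three.inverseImage V₂)
    (hN.retract_weq.inverseImage V₂) hwfsP₃ hwfsP₄ ?_, hWeq, ?_, ?_⟩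
  · intro X Y f hf
    rw [hFM] at hf
    have hf' := llp_inverseImage_le adj₁ adj₄ iso₂ hCF' _ hf
    rw [← hAN] at hf'
    rw [hWeq]
    exact hf'.2
  · intro X Y f hf
    rw [hCN] at hf
    have hf' := rlp_inverseImage_le adj₁ adj₃ adj₄ iso₂ hCF _ hf
    rw [← hAM] at hf'
    rw [← hWeq]
    exact hf'.2
  · rw [hAM, hCN]
    exact llp_inverseImage_le adj₁ adj₄ iso₂ hCF
  · rw [hAN, hFM]
    exact rlp_inverseImage_le adj₁ adj₃ adj₄ iso₂ hCF'

end InducedModel
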